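/- Let n ≥ 5 and W = S_{n+1}. Let I = R − {s_i} with 2 ≤ i ≤ n−1 and J = R − {s_1, s_j} with 2 < j < n−1, and assume j > i. Define τ₀ ∈ W in one-line notation by: τ₀(1) = i; τ₀(k) = n+3−k for 2 ≤ k ≤ j−i+1; τ₀(k) = j+1−k for j−i+2 ≤ k ≤ j; and τ₀(k) = n+2+i−k for j+1 ≤ k ≤ n+1 (so τ₀ = (i, n+1, n, ..., n+2−(j−i), i−1, i−2, ..., 1, n+1−(j−i), ..., i+1)). Then τ₀ ∈ X⁺_{I,J} and τ₀ is the unique minimal element of X⁺_{I,J} in the Bruhat order. -/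

import Mathlib

/-- The number of inversions (Coxeter length) of a permutation of `Fin m`. -/
def sLen {m : ℕ} (w : Equiv.Perm (Fin m)) : ℕ :=
  (Finset.univ.filter fun p : Fin m × Fin m => p.1 < p.2 ∧ w p.2 < w p.1).card

/-- The Bruhat order on the symmetric group: generated by `w < t * w` for a
transposition `t` with `sLen (t * w) > sLen w`. -/
def bruhatLE {m : ℕ} (u v : Equiv.Perm (Fin m)) : Prop :=
  Relation.ReflTransGen
    (fun x y => (∃ a b : Fin m, a ≠ b ∧ y = Equiv.swap a b * x) ∧ sLen x < sLen y) u v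

/-- The right descent set of `w`, as a set of indices of simple reflections:
`i : Fin n` stands for the simple transposition `s_{i+1} = (i+1, i+2)` (1-based). -/
def Des {n : ℕ} (w : Equiv.Perm (Fin (n + 1))) : Set (Fin n) :=
  {i | w i.succ < w i.castSucc}

/-- Maximal-length double-coset representatives:
`X⁺_{I,J} = {w : I ⊆ Des (w⁻¹) ∧ J ⊆ Des w}`. -/
def Xplus {n : ℕ} (I J : Set (Fin n)) : Set (Equiv.Perm (Fin (n + 1))) :=
  {w | I ⊆ Des w⁻¹ ∧ J ⊆ Des w}

/-- A subset of the symmetric group is totally ordered (a chain) in Bruhat order. -/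
def IsChainOn {m : ℕ} (X : Set (Equiv.Perm (Fin m))) : Prop :=
  ∀ x ∈ X, ∀ y ∈ X, bruhatLE x y ∨ bruhatLE y x

/-- A subset of the symmetric group, with the restriction of the Bruhat order,
is a lattice: every pair has a least upper bound and a greatest lower bound in the set. -/
def IsLatticeOn {m : ℕ} (X : Set (Equiv.Perm (Fin m))) : Prop :=
  (∀ x ∈ X, ∀ y ∈ X, ∃ z ∈ X, bruhatLE x z ∧ bruhatLE y z ∧
      ∀ t ∈ X, bruhatLE x t → bruhatLE y t → bruhatLE z t) ∧
  (∀ x ∈ X, ∀ y ∈ X, ∃ z ∈ X, bruhatLE z x ∧ bruhatLE z y ∧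
      ∀ t ∈ X, bruhatLE t x → bruhatLE t y → bruhatLE t z)

/-- `y` covers `x` in the restriction of the Bruhat order to `X`. -/
def CoversIn {m : ℕ} (X : Set (Equiv.Perm (Fin m))) (x y : Equiv.Perm (Fin m)) : Prop :=
  x ∈ X ∧ y ∈ X ∧ bruhatLE x y ∧ x ≠ y ∧
    ∀ z ∈ X, bruhatLE x z → bruhatLE z y → z = x ∨ z = y

/-- Right multiplication by an adjacent transposition at a descent lowers the length. -/
theorem sLen_mul_swap_lt {m : ℕ} (w : Equiv.Perm (Fin m)) (k l : Fin m)
    (hkl : (l : ℕ) = k + 1) (h : w l < w k) : sLen (w * Equiv.swap k l) < sLen w := by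
  have hlt : ∀ u v : Fin m, u < v → ¬(u = k ∧ v = l) →
      Equiv.swap k l u < Equiv.swap k l v := by
    intro u v huv hne
    simp only [Equiv.swap_apply_def]
    split_ifs <;> simp only [Fin.ext_iff, Fin.lt_def] at * <;> omega
  unfold sLen
  set A := Finset.univ.filter fun p : Fin m × Fin m =>
    p.1 < p.2 ∧ (w * Equiv.swap k l) p.2 < (w * Equiv.swap k l) p.1
  set B := Finset.univ.filter fun p : Fin m × Fin m => p.1 < p.2 ∧ w p.2 < w p.1
  have hmem : ((k, l) : Fin m × Fin m) ∈ B := by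
    simp only [B, Finset.mem_filter, Finset.mem_univ, true_and]
    exact ⟨by rw [Fin.lt_def]; omega, h⟩
  have hle : A.card ≤ (B.erase (k, l)).card := by
    refine Finset.card_le_card_of_injOn
      (Prod.map (Equiv.swap k l) (Equiv.swap k l)) ?_
      ((Equiv.swap k l).injective.prodMap (Equiv.swap k l).injective).injOn
    rintro ⟨u, v⟩ huv
    replace huv := (Finset.mem_filter.mp huv).2
    obtain ⟨huv, hw⟩ := huv
    simp only [Equiv.Perm.mul_apply] at huv hw
    have hne : ¬(u = k ∧ v = l) := by
      rintro ⟨rfl, rfl⟩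
      rw [Equiv.swap_apply_left, Equiv.swap_apply_right] at hw
      exact lt_asymm h hw
    simp only [B, Finset.mem_coe, Finset.mem_erase, Finset.mem_filter, Finset.mem_univ, true_and,
      Prod.map_apply, ne_eq, Prod.mk.injEq]
    refine ⟨?_, hlt u v huv hne, hw⟩
    rintro ⟨hu, hv⟩
    have hu' : u = l := by
      rw [← Equiv.swap_apply_left k l] at hu; simpa using congrArg (Equiv.swap k l) hu
    have hv' : v = k := by
      rw [← Equiv.swap_apply_right k l] at hv; simpa using congrArg (Equiv.swap k l) hv
    subst hu' hv'
    rw [Fin.lt_def] at huv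
    omega
  rw [Finset.card_erase_of_mem hmem] at hle
  have := Finset.card_pos.mpr ⟨_, hmem⟩
  omega

/-- The values below `i` occur in decreasing order in `w`, and so do the values at least `i`. -/
def ShuffleDecreasing {m : ℕ} (i : ℕ) (w : Equiv.Perm (Fin m)) : Prop :=
  ∀ u v : Fin m, u < v → ((w u : ℕ) < i ↔ (w v : ℕ) < i) → w v < w u

/-- A decreasing shuffle is determined by the positions of its small values. -/
theorem ShuffleDecreasing.eq_of_lt_iff {m i : ℕ} {w τ : Equiv.Perm (Fin m)}
    (hw : ShuffleDecreasing i w) (hτ : ShuffleDecreasing i τ)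
    (h : ∀ k, (w k : ℕ) < i ↔ (τ k : ℕ) < i) : w = τ := by
  have key : ∀ {w τ : Equiv.Perm (Fin m)}, ShuffleDecreasing i w →
      (∀ k, (w k : ℕ) < i ↔ (τ k : ℕ) < i) → ∀ k, (∀ l < k, w l = τ l) → ¬ w k < τ k := by
    intro w τ hw h k ih hlt
    obtain ⟨l, hl⟩ := w.surjective (τ k)
    rcases lt_trichotomy l k with hlk | rfl | hlk
    · exact hlk.ne (τ.injective ((ih l hlk).symm.trans hl))
    · exact hlt.ne hl
    · exact lt_asymm hlt (hl ▸ hw k l hlk (by rw [hl]; exact h k))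
  ext1 k
  induction k using WellFoundedLT.induction with
  | ind k ih =>
    exact le_antisymm (not_lt.mp (key hτ (fun k => (h k).symm) k fun l hl => (ih l hl).symm))
      (not_lt.mp (key hw h k ih))

/-- Exchanging an adjacent large-small pair preserves decreasing shuffles. -/
theorem ShuffleDecreasing.mul_swap {m i : ℕ} {w : Equiv.Perm (Fin m)}
    (hw : ShuffleDecreasing i w) {k l : Fin m} (hkl : (l : ℕ) = k + 1)
    (hk : i ≤ (w k : ℕ)) (hl : (w l : ℕ) < i) : ShuffleDecreasing i (w * Equiv.swap k l) := by
  intro u v huv hiff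
  simp only [Equiv.Perm.mul_apply] at hiff ⊢
  refine hw _ _ ?_ hiff
  by_cases hne : u = k ∧ v = l
  · obtain ⟨rfl, rfl⟩ := hne
    rw [Equiv.swap_apply_left, Equiv.swap_apply_right] at hiff
    omega
  · simp only [Equiv.swap_apply_def]
    split_ifs <;> simp only [Fin.ext_iff, Fin.lt_def] at * <;> omega

/-- Undoing an adjacent descent goes down in Bruhat order. -/
theorem bruhatLE_of_mul_swap {m : ℕ} {τ w : Equiv.Perm (Fin m)} {k l : Fin m}
    (hkl : (l : ℕ) = k + 1) (h : w l < w k) (hle : bruhatLE τ (w * Equiv.swap k l)) :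
    bruhatLE τ w := by
  refine Relation.ReflTransGen.tail hle ⟨⟨w l, w k, h.ne, ?_⟩, sLen_mul_swap_lt w k l hkl h⟩
  rw [Equiv.mul_swap_eq_swap_mul, ← mul_assoc, Equiv.swap_comm (w l), Equiv.swap_mul_self, one_mul]

/-- A map descending at every step between `a` and `b` has `f b < f a`. -/
theorem apply_lt_of_succ_lt_castSucc {n : ℕ} (f : Fin (n + 1) → Fin (n + 1)) (a b : Fin (n + 1))
    (hab : a < b)
    (h : ∀ k : Fin n, (a : ℕ) ≤ k → (k : ℕ) < b → f k.succ < f k.castSucc) : f b < f a := by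
  induction b using Fin.induction with
  | zero => exact absurd hab (Fin.not_lt_zero a)
  | succ b ih =>
    have hb : (a : ℕ) ≤ b := by
      rw [Fin.lt_def, Fin.val_succ] at hab
      omega
    have hstep := h b hb (by simp)
    rcases hb.eq_or_lt with hb | hb
    · have : a = b.castSucc := Fin.ext hb
      rwa [this]
    · refine hstep.trans (ih hb fun k hk hkb => h k hk ?_)
      simp only [Fin.val_castSucc, Fin.val_succ] at hkb ⊢
      omega

theorem shuffleDecreasing_of_subset_Des_inv {n i : ℕ} {w : Equiv.Perm (Fin (n + 1))}
    (h : ∀ k : Fin n, (k : ℕ) + 1 ≠ i → k ∈ Des w⁻¹) : ShuffleDecreasing i w := by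
  intro u v huv hiff
  by_contra hlt
  have hlt : w u < w v := lt_of_le_of_ne (not_lt.mp hlt) (w.injective.ne huv.ne)
  have := apply_lt_of_succ_lt_castSucc (⇑w⁻¹) (w u) (w v) hlt
    fun k hk hkv => h k (by omega)
  simp only [Equiv.Perm.coe_inv, Equiv.symm_apply_apply] at this
  exact lt_asymm huv this

/-- A decreasing shuffle in which the only admissible large-small adjacency is the one that
would put the second small value before position `d` has its small values exactly at
`0` and at positions `d, ..., d + i - 2`. -/
theorem ShuffleDecreasing.lt_iff_of_forall_adjacent {m i d : ℕ} (hi : 2 ≤ i) (hm : i ≤ m)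
    (hd : 1 < d)
    {w : Equiv.Perm (Fin m)} (hw : ShuffleDecreasing i w)
    (hpos : ∀ k, (w k : ℕ) = i - 2 → d ≤ k)
    (hadj : ∀ k l : Fin m, (l : ℕ) = k + 1 → i ≤ (w k : ℕ) → (w l : ℕ) < i →
      (k : ℕ) + 1 = d ∧ (w l : ℕ) = i - 2) (k : Fin m) :
    (w k : ℕ) < i ↔ (k : ℕ) = 0 ∨ (d ≤ (k : ℕ) ∧ (k : ℕ) + 2 ≤ d + i) := by
  have hprev : ∀ k : Fin m, (k : ℕ) ≠ 0 → ∃ l : Fin m, (k : ℕ) = l + 1 := fun k hk =>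
    ⟨⟨k - 1, by omega⟩, by simp only; omega⟩
  have hwlt : ∀ u v : Fin m, (u : ℕ) < v → (w u : ℕ) < i → (w v : ℕ) < i →
      (w v : ℕ) < w u := fun u v huv hu hv => hw u v huv (iff_of_true hu hv)
  have hwinj : ∀ u v : Fin m, (w u : ℕ) = w v → (u : ℕ) = v := fun u v h =>
    congrArg Fin.val (w.injective (Fin.ext h))
  have hfirst : ∀ k : Fin m, (w k : ℕ) = i - 1 → (k : ℕ) = 0 := by
    intro k hk
    by_contra hk0
    obtain ⟨l, hl⟩ := hprev k hk0
    by_cases hli : (w l : ℕ) < i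
    · have := hwlt l k (by omega) hli (by omega)
      omega
    · have := hadj l k hl (by omega) (by omega)
      omega
  have hrest : ∀ t, t + 2 ≤ i → ∀ k : Fin m, (w k : ℕ) = i - 2 - t → (k : ℕ) = d + t := by
    intro t
    induction t with
    | zero =>
      intro _ k hk
      have hdk := hpos k (by omega)
      obtain ⟨l, hl⟩ := hprev k (by omega)
      by_cases hli : (w l : ℕ) < i
      · have h1 := hwlt l k (by omega) hli (by omega)
        have := hfirst l (by omega)
        omega
      · have := hadj l k hl (by omega) (by omega)
        omega
    | succ t ih =>
      intro ht k hk
      obtain ⟨q, hq⟩ := w.surjective ⟨i - 2 - t, by omega⟩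
      have hq : (w q : ℕ) = i - 2 - t := congrArg Fin.val hq
      have hqd := ih (by omega) q hq
      have hqk : (q : ℕ) < k := by
        by_contra hle
        have hne : (k : ℕ) ≠ q := fun h => by
          have : k = q := Fin.ext h
          subst this
          omega
        have := hwlt k q (by omega) (by omega) (by omega)
        omega
      obtain ⟨l, hl⟩ := hprev k (by omega)
      by_cases hli : (w l : ℕ) < i
      · have h1 := hwlt l k (by omega) hli (by omega)
        by_cases hlq : (l : ℕ) = q
        · omega
        · have := hwlt q l (by omega) (by omega) hli
          omega
      · have := hadj l k hl (by omega) (by omega)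
        omega
  constructor
  · intro hk
    by_cases h1 : (w k : ℕ) = i - 1
    · exact Or.inl (hfirst k h1)
    · have := hrest (i - 2 - w k) (by omega) k (by omega)
      omega
  · intro hk
    have : ∃ v : Fin m, (v : ℕ) < i ∧ ∀ q, w q = v → (q : ℕ) = k := by
      rcases hk with hk | ⟨h1, h2⟩
      · exact ⟨⟨i - 1, by omega⟩, by simp only; omega, fun q hq =>
          (hfirst q (congrArg Fin.val hq)).trans hk.symm⟩
      · refine ⟨⟨i - 2 - (k - d), by omega⟩, by simp only; omega, fun q hq => ?_⟩
        have := hrest (k - d) (by omega) q (congrArg Fin.val hq)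
        omega
    obtain ⟨v, hv, hvq⟩ := this
    obtain ⟨q, hq⟩ := w.surjective v
    rw [← Fin.ext (hvq q hq), hq]
    exact hv

/-- The decreasing shuffle with small positions `0, d, ..., d + i - 2` lies below every decreasing
shuffle whose second small value occurs at position at least `d`. -/
theorem ShuffleDecreasing.bruhatLE_of_le_position {m i d : ℕ} (hi : 2 ≤ i) (hm : i ≤ m)
    (hd : 1 < d) {τ : Equiv.Perm (Fin m)} (hτ : ShuffleDecreasing i τ)
    (hτpos : ∀ k, (τ k : ℕ) < i ↔ (k : ℕ) = 0 ∨ (d ≤ (k : ℕ) ∧ (k : ℕ) + 2 ≤ d + i))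
    (w : Equiv.Perm (Fin m)) (hw : ShuffleDecreasing i w)
    (hpos : ∀ k, (w k : ℕ) = i - 2 → d ≤ k) : bruhatLE τ w := by
  induction hN : sLen w using Nat.strong_induction_on generalizing w with
  | _ N ih =>
    by_cases hadj : ∀ k l : Fin m, (l : ℕ) = k + 1 → i ≤ (w k : ℕ) → (w l : ℕ) < i →
        (k : ℕ) + 1 = d ∧ (w l : ℕ) = i - 2
    · rw [hw.eq_of_lt_iff hτ fun k =>
        (hw.lt_iff_of_forall_adjacent hi hm hd hpos hadj k).trans (hτpos k).symm]
      exact Relation.ReflTransGen.refl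
    · push Not at hadj
      obtain ⟨k, l, hkl, hk, hl, hne⟩ := hadj
      have hlt : w l < w k := by
        rw [Fin.lt_def]
        omega
      refine bruhatLE_of_mul_swap hkl hlt
        (ih _ (hN ▸ sLen_mul_swap_lt w k l hkl hlt) _ (hw.mul_swap hkl hk hl) ?_ rfl)
      intro p hp
      rw [Equiv.Perm.mul_apply] at hp
      have hsp := hpos _ hp
      by_cases hpk : p = k
      · subst hpk
        rw [Equiv.swap_apply_left] at hp hsp
        by_contra hlt
        exact hne (by omega) hp
      · by_cases hpl : p = l
        · subst hpl
          rw [Equiv.swap_apply_right] at hp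
          omega
        · rwa [Equiv.swap_apply_of_ne_of_ne hpk hpl] at hsp

/-- If `w` decreases on positions `1, ..., j - 1`, its second small value is at position at
least `j - i + 1`. -/
theorem ShuffleDecreasing.le_position_of_Des {n i j : ℕ} (hi : 2 ≤ i) (hj : j ≤ n)
    {w : Equiv.Perm (Fin (n + 1))} (hw : ShuffleDecreasing i w) (hij : i < j)
    (hdes : ∀ k : Fin n, (k : ℕ) ≠ 0 → (k : ℕ) + 1 ≠ j → k ∈ Des w)
    (k : Fin (n + 1)) (hk : (w k : ℕ) = i - 2) : j - i + 1 ≤ (k : ℕ) := by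
  by_cases hkj : j ≤ (k : ℕ)
  · omega
  have hk0 : (k : ℕ) ≠ 0 := by
    intro hk0
    obtain ⟨q, hq⟩ := w.surjective ⟨i - 1, by omega⟩
    have hq : (w q : ℕ) = i - 1 := congrArg Fin.val hq
    have hne : k ≠ q := by
      rintro rfl
      omega
    have hlt : k < q := by
      rw [Fin.lt_def]
      rw [Ne, Fin.ext_iff] at hne
      omega
    have := hw k q hlt (by omega)
    rw [Fin.lt_def] at this
    omega
  have hdrop : ∀ t, ∀ q : Fin (n + 1), (q : ℕ) = k + t → (q : ℕ) < j →
      (w q : ℕ) + t ≤ i - 2 := by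
    intro t
    induction t with
    | zero =>
      intro q hq _
      have : q = k := Fin.ext hq
      subst this
      omega
    | succ t ih =>
      intro q hq hqj
      have hd : w _ < w _ := hdes ⟨k + t, by omega⟩ (by simp only; omega) (by simp only; omega)
      have hsucc : Fin.succ ⟨k + t, by omega⟩ = q := Fin.ext (by simp only [Fin.val_succ]; omega)
      rw [hsucc, Fin.lt_def] at hd
      have := ih (Fin.castSucc ⟨k + t, by omega⟩) rfl (by simp only [Fin.val_castSucc]; omega)
      omega
  have := hdrop (j - 1 - k) ⟨j - 1, by omega⟩ (by simp only; omega) (by simp only; omega)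
  omega

/-- Let `n ≥ 5`, `I = R − {s_i}` with `2 ≤ i ≤ n−1`, `J = R − {s_1, s_j}` with
`2 < j < n−1` and `j > i` (all 1-based).  Let
`τ₀ = (i, n+1, n, ..., n+2−(j−i), i−1, ..., 1, n+1−(j−i), ..., i+1)` in one-line
notation; in 0-based terms `τ₀(0) = i−1`, `τ₀(k) = n+1−k` for `1 ≤ k ≤ j−i`,
`τ₀(k) = j−1−k` for `j−i+1 ≤ k ≤ j−1`, and `τ₀(k) = n+i−k` for `j ≤ k ≤ n`.
Then `τ₀ ∈ X⁺_{I,J}` and `τ₀` is the unique minimal element of `X⁺_{I,J}`. -/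
theorem stmt_11 (n : ℕ) (hn : 5 ≤ n) (i j : ℕ)
    (hi1 : 2 ≤ i) (hi2 : i ≤ n - 1) (hj1 : 2 < j) (hj2 : j < n - 1) (hji : i < j)
    (I J : Set (Fin n))
    (hI : I = ({⟨i - 1, by omega⟩} : Set (Fin n))ᶜ)
    (hJ : J = ({⟨0, by omega⟩, ⟨j - 1, by omega⟩} : Set (Fin n))ᶜ)
    (τ₀ : Equiv.Perm (Fin (n + 1)))
    (hτ : (τ₀ ⟨0, by omega⟩ : ℕ) = i - 1 ∧
      ∀ k : Fin (n + 1),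
        (1 ≤ (k : ℕ) → (k : ℕ) ≤ j - i → (τ₀ k : ℕ) = n + 1 - (k : ℕ)) ∧
        (j - i + 1 ≤ (k : ℕ) → (k : ℕ) ≤ j - 1 → (τ₀ k : ℕ) = j - 1 - (k : ℕ)) ∧
        (j ≤ (k : ℕ) → (τ₀ k : ℕ) = n + i - (k : ℕ))) :
    τ₀ ∈ Xplus I J ∧ ∀ w ∈ Xplus I J, bruhatLE τ₀ w := by
  obtain ⟨h0, hval⟩ := hτ
  have hI' : ∀ k : Fin n, k ∈ I ↔ (k : ℕ) + 1 ≠ i := by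
    intro k
    simp only [hI, Set.mem_compl_iff, Set.mem_singleton_iff, Fin.ext_iff]
    omega
  have hJ' : ∀ k : Fin n, k ∈ J ↔ (k : ℕ) ≠ 0 ∧ (k : ℕ) + 1 ≠ j := by
    intro k
    simp only [hJ, Set.mem_compl_iff, Set.mem_insert_iff, Set.mem_singleton_iff, Fin.ext_iff]
    omega
  have hcases : ∀ k : Fin (n + 1), ((k : ℕ) = 0 ∧ (τ₀ k : ℕ) = i - 1) ∨
      (1 ≤ (k : ℕ) ∧ (k : ℕ) ≤ j - i ∧ (τ₀ k : ℕ) = n + 1 - k) ∨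
      (j - i + 1 ≤ (k : ℕ) ∧ (k : ℕ) ≤ j - 1 ∧ (τ₀ k : ℕ) = j - 1 - k) ∨
      (j ≤ (k : ℕ) ∧ (τ₀ k : ℕ) = n + i - k) := by
    intro k
    obtain ⟨h1, h2, h3⟩ := hval k
    by_cases hk : (k : ℕ) = 0
    · have : k = ⟨0, by omega⟩ := Fin.ext hk
      exact Or.inl ⟨hk, by rw [this]; exact h0⟩
    · omega
  have hmem : τ₀ ∈ Xplus I J := by
    refine ⟨fun k hk => ?_, fun k hk => ?_⟩
    · have hk := (hI' k).mp hk
      change τ₀⁻¹ k.succ < τ₀⁻¹ k.castSucc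
      have ha := hcases (τ₀⁻¹ k.succ)
      have hb := hcases (τ₀⁻¹ k.castSucc)
      simp only [Equiv.Perm.coe_inv, Equiv.apply_symm_apply, Fin.val_succ, Fin.val_castSucc] at ha hb
      rw [Equiv.Perm.coe_inv, Fin.lt_def]
      omega
    · have hk := (hJ' k).mp hk
      change τ₀ k.succ < τ₀ k.castSucc
      have ha := hcases k.succ
      have hb := hcases k.castSucc
      simp only [Fin.val_succ, Fin.val_castSucc] at ha hb
      rw [Fin.lt_def]
      omega
  have hshuffle : ∀ w ∈ Xplus I J, ShuffleDecreasing i w := fun w hw =>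
    shuffleDecreasing_of_subset_Des_inv fun k hk => hw.1 ((hI' k).mpr hk)
  refine ⟨hmem, fun w hw => ?_⟩
  refine (hshuffle τ₀ hmem).bruhatLE_of_le_position (d := j - i + 1) hi1 (by omega) (by omega)
    (fun k => ?_) w (hshuffle w hw) ?_
  · have := hcases k
    omega
  · exact (hshuffle w hw).le_position_of_Des hi1 (by omega) (by omega)
      fun k hk0 hkj => hw.2 ((hJ' k).mpr ⟨hk0, hkj⟩)
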